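/- arXiv:1512.07515 — 5 statements merged into one kernel-verified Lean document; each statement's English description precedes it below -/
import Mathlib

section
/- Let X be a Hausdorff countably compact topological space that possesses a point-countable Pytkeev network. Then X is compact and metrizable. -/
/-- `x` is an accumulation point of `A`: every neighborhood of `x` contains
infinitely many points of `A`. -/
def IsAccumulationPt {X : Type*} [TopologicalSpace X] (x : X) (A : Set X) : Prop :=
  ∀ U ∈ nhds x, (U ∩ A).Infinite

/-- `N` is a network at the point `x`. -/
def IsNetworkAt {X : Type*} [TopologicalSpace X] (N : Set (Set X)) (x : X) : Prop :=
  ∀ U : Set X, IsOpen U → x ∈ U → ∃ P ∈ N, x ∈ P ∧ P ⊆ U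

/-- `N` is a Pytkeev network at the point `x`. -/
def IsPytkeevNetworkAt {X : Type*} [TopologicalSpace X] (N : Set (Set X)) (x : X) : Prop :=
  IsNetworkAt N x ∧
    ∀ U : Set X, IsOpen U → x ∈ U → ∀ A : Set X, IsAccumulationPt x A →
      ∃ P ∈ N, P ⊆ U ∧ (P ∩ A).Infinite

/-- `N` is a Pytkeev network in `X`. -/
def IsPytkeevNetwork {X : Type*} [TopologicalSpace X] (N : Set (Set X)) : Prop :=
  ∀ x : X, IsPytkeevNetworkAt N x

/-- `N` is point-countable: each point belongs to at most countably many members of `N`. -/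
def IsPointCountable {X : Type*} (N : Set (Set X)) : Prop :=
  ∀ x : X, {P ∈ N | x ∈ P}.Countable

/-- `X` is countably compact: every countable open cover has a finite subcover. -/
def IsCountablyCompactSpace (X : Type*) [TopologicalSpace X] : Prop :=
  ∀ U : ℕ → Set X, (∀ n, IsOpen (U n)) → (⋃ n, U n) = Set.univ →
    ∃ s : Finset ℕ, (⋃ n ∈ s, U n) = Set.univ

open Set in
/-- In a countably compact space every infinite set has an accumulation point. -/
theorem IsCountablyCompactSpace.exists_isAccumulationPt {X : Type*} [TopologicalSpace X]
    (hcc : IsCountablyCompactSpace X) {A : Set X} (hA : A.Infinite) :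
    ∃ x, IsAccumulationPt x A := by
  let a : ℕ ↪ A := hA.natEmbedding
  let F : ℕ → Set X := fun n => closure ((fun m => (a m : X)) '' Ici n)
  have hne : ∃ z, ∀ n, z ∈ F n := by
    by_contra! h
    obtain ⟨s, hs⟩ := hcc (fun n => (F n)ᶜ) (fun n => isClosed_closure.isOpen_compl)
      (eq_univ_of_forall fun z => mem_iUnion.2 (h z))
    have hz : (a (s.sup id) : X) ∈ ⋃ n ∈ s, (F n)ᶜ := hs ▸ mem_univ _
    simp only [mem_iUnion] at hz
    obtain ⟨n, hn, hz⟩ := hz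
    exact hz (subset_closure ⟨_, Finset.le_sup (f := id) hn, rfl⟩)
  obtain ⟨z, hz⟩ := hne
  refine ⟨z, fun U hU hfin => ?_⟩
  have hinj : Function.Injective fun m => (a m : X) :=
    Subtype.val_injective.comp a.injective
  obtain ⟨n, hn⟩ := (hfin.preimage hinj.injOn).bddAbove
  obtain ⟨_, hy, m, hm, rfl⟩ := mem_closure_iff_nhds.1 (hz (n + 1)) U hU
  have h1 : m ≤ n := hn ⟨hy, (a m).2⟩
  have h2 : n + 1 ≤ m := hm
  omega

open Set in
/-- For a point-countable family `N` there is a countable set `D` meeting the complement of every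
finite union of members of `N` that meet `D`, unless this union is the whole space. -/
theorem IsPointCountable.exists_countable_closed_off {X : Type*} {N : Set (Set X)}
    (hpc : IsPointCountable N) :
    ∃ D : Set X, D.Countable ∧ ∀ F : Set (Set X), F.Finite →
      F ⊆ {P ∈ N | (P ∩ D).Nonempty} → ⋃₀ F ≠ univ → ∃ d ∈ D, d ∉ ⋃₀ F := by
  rcases isEmpty_or_nonempty X with hX | hX
  · exact ⟨∅, countable_empty, fun F _ _ h => (h (Subsingleton.elim _ _)).elim⟩
  have hg : ∀ F : Set (Set X), ∃ x, ⋃₀ F ≠ univ → x ∉ ⋃₀ F := fun F => by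
    by_cases h : ⋃₀ F = univ
    · exact ⟨Classical.arbitrary X, fun h' => (h' h).elim⟩
    · obtain ⟨x, hx⟩ := (ne_univ_iff_exists_notMem _).1 h
      exact ⟨x, fun _ => hx⟩
  choose g hg using hg
  let M : Set X → Set (Set X) := fun E => {P ∈ N | (P ∩ E).Nonempty}
  have hMc : ∀ E : Set X, E.Countable → (M E).Countable := fun E hE => by
    refine (hE.biUnion fun x _ => hpc x).mono ?_
    rintro P ⟨hP, x, hxP, hxE⟩
    exact mem_biUnion hxE ⟨hP, hxP⟩
  let D : ℕ → Set X := fun n => Nat.rec ∅ (fun _ E => E ∪ g '' {F | F.Finite ∧ F ⊆ M E}) n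
  have hD : ∀ n, D (n + 1) = D n ∪ g '' {F | F.Finite ∧ F ⊆ M (D n)} := fun n => rfl
  have hDc : ∀ n, (D n).Countable := fun n => by
    induction n with
    | zero => exact countable_empty
    | succ n ih =>
      rw [hD]
      exact ih.union ((countable_ofPred_finite_subset (hMc _ ih)).image g)
  have hDm : Monotone D := monotone_nat_of_le_succ fun n => subset_union_left
  refine ⟨⋃ n, D n, countable_iUnion hDc, fun F hF hFM hne => ?_⟩
  have hMm : Monotone fun n => M (D n) := fun m n hmn P hP =>
    ⟨hP.1, hP.2.mono (inter_subset_inter_right P (hDm hmn))⟩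
  have hsub : F ⊆ ⋃ n, M (D n) := fun P hP => by
    obtain ⟨hPN, x, hxP, hx⟩ := hFM hP
    obtain ⟨n, hn⟩ := mem_iUnion.1 hx
    exact mem_iUnion.2 ⟨n, hPN, x, hxP, hn⟩
  obtain ⟨n, hn⟩ := hMm.directed_le.exists_mem_subset_of_finset_subset_biUnion
    (s := hF.toFinset) (by simpa using hsub)
  rw [hF.coe_toFinset] at hn
  exact ⟨g F, mem_iUnion.2 ⟨n + 1, Or.inr ⟨F, ⟨hF, hn⟩, rfl⟩⟩, hg F hne⟩

open Set in
/-- In a countably compact space with a point-countable Pytkeev network, there is a countable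
family of sets that finitely refines every open cover. -/
theorem IsPytkeevNetwork.exists_countable_finite_refinement {X : Type*} [TopologicalSpace X]
    (hcc : IsCountablyCompactSpace X) {N : Set (Set X)} (hN : IsPytkeevNetwork N)
    (hpc : IsPointCountable N) :
    ∃ C : Set (Set X), C.Countable ∧ ∀ 𝒰 : Set (Set X), (∀ U ∈ 𝒰, IsOpen U) → ⋃₀ 𝒰 = univ →
      ∃ F : Set (Set X), F.Finite ∧ F ⊆ C ∧ ⋃₀ F = univ ∧ ∀ P ∈ F, ∃ U ∈ 𝒰, P ⊆ U := by
  obtain ⟨D, hDc, hD⟩ := hpc.exists_countable_closed_off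
  have hC : {P ∈ N | (P ∩ D).Nonempty}.Countable := by
    refine (hDc.biUnion fun x _ => hpc x).mono ?_
    rintro P ⟨hP, x, hxP, hxD⟩
    exact mem_biUnion hxD ⟨hP, hxP⟩
  refine ⟨_, hC, fun 𝒰 hUo hUc => ?_⟩
  by_contra! hcon
  obtain ⟨p, hp⟩ := countable_iff_exists_subset_range.1 hC
  let R : Set (Set X) := {P | (P ∈ N ∧ (P ∩ D).Nonempty) ∧ ∃ U ∈ 𝒰, P ⊆ U}
  have hpick : ∀ n : ℕ, ∃ d ∈ D, d ∉ ⋃₀ (p '' Iio n ∩ R) := fun n => by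
    have hfin : (p '' Iio n ∩ R).Finite := ((finite_Iio n).image p).inter_of_left R
    have hsub : p '' Iio n ∩ R ⊆ {P ∈ N | (P ∩ D).Nonempty} := fun P hP => hP.2.1
    refine hD _ hfin hsub fun hcov => ?_
    obtain ⟨P, hP, hPU⟩ := hcon _ hfin hsub hcov
    obtain ⟨U, hU, hPU'⟩ := hP.2.2
    exact hPU U hU hPU'
  choose x hxD hx using hpick
  have hR : ∀ P ∈ R, {n | x n ∈ P}.Finite := fun P hP => by
    obtain ⟨i, rfl⟩ := hp hP.1
    refine (finite_Iic i).subset fun n hn => ?_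
    by_contra hlt
    exact hx n ⟨p i, ⟨⟨i, mem_Iio.2 (not_le.1 (mt mem_Iic.2 hlt)), rfl⟩, hP⟩, hn⟩
  have hmem : ∀ z : X, ∃ U ∈ 𝒰, z ∈ U := fun z => mem_sUnion.1 (hUc ▸ mem_univ z)
  have hinf : (range x).Infinite := fun hfin => by
    have : Finite (range x) := hfin
    obtain ⟨⟨_, k, rfl⟩, hk⟩ := Finite.exists_infinite_fiber (rangeFactorization x)
    obtain ⟨U, hU, hkU⟩ := hmem (x k)
    obtain ⟨P, hPN, hkP, hPU⟩ := (hN (x k)).1 U (hUo U hU) hkU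
    refine infinite_coe_iff.1 hk
      ((hR P ⟨⟨hPN, x k, hkP, hxD k⟩, U, hU, hPU⟩).subset fun n hn => ?_)
    have hnk : x n = x k := congrArg Subtype.val hn
    simpa only [mem_ofPred_eq, hnk] using hkP
  obtain ⟨z, hz⟩ := hcc.exists_isAccumulationPt hinf
  obtain ⟨U, hU, hzU⟩ := hmem z
  obtain ⟨P, hPN, hPU, hPinf⟩ := (hN z).2 U (hUo U hU) hzU _ hz
  obtain ⟨_, hkP, k, rfl⟩ := hPinf.nonempty
  refine hPinf (((hR P ⟨⟨hPN, x k, hkP, hxD k⟩, U, hU, hPU⟩).image x).subset ?_)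
  rintro _ ⟨hy, n, rfl⟩
  exact ⟨n, hy, rfl⟩

open Set in
/-- A space with a family of sets that finitely refines every open cover is compact. -/
theorem compactSpace_of_finite_refinement {X : Type*} [TopologicalSpace X]
    (h : ∀ 𝒰 : Set (Set X), (∀ U ∈ 𝒰, IsOpen U) → ⋃₀ 𝒰 = univ →
      ∃ F : Set (Set X), F.Finite ∧ ⋃₀ F = univ ∧ ∀ P ∈ F, ∃ U ∈ 𝒰, P ⊆ U) :
    CompactSpace X := by
  refine ⟨isCompact_of_finite_subcover fun {ι} U hUo hUc => ?_⟩
  classical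
  obtain ⟨F, hF, hFc, hFU⟩ := h (range U) (forall_mem_range.2 hUo)
    (by rw [sUnion_range]; exact univ_subset_iff.1 hUc)
  simp only [exists_range_iff] at hFU
  rcases isEmpty_or_nonempty ι with hι | hι
  · exact ⟨∅, by simpa using hUc⟩
  choose! i hi using hFU
  refine ⟨hF.toFinset.image i, fun x _ => ?_⟩
  obtain ⟨P, hP, hxP⟩ := mem_sUnion.1 (hFc ▸ mem_univ x : x ∈ ⋃₀ F)
  exact mem_biUnion (Finset.mem_image_of_mem i (hF.mem_toFinset.2 hP)) (hi P hP hxP)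

/-- A compact space whose points are separated by a countable family of open sets is second
countable. -/
theorem secondCountableTopology_of_countable_separating {X : Type*} [t : TopologicalSpace X]
    [CompactSpace X] {S : Set (Set X)} (hS : S.Countable) (hSo : ∀ O ∈ S, IsOpen O)
    (hsep : ∀ x y : X, x ≠ y → ∃ O ∈ S, ∃ O' ∈ S, x ∈ O ∧ y ∈ O' ∧ Disjoint O O') :
    SecondCountableTopology X := by
  let t' : TopologicalSpace X := TopologicalSpace.generateFrom S
  have hT2 : @T2Space X t' := @T2Space.mk X t' fun x y hxy => by
    obtain ⟨O, hO, O', hO', hx, hy, hd⟩ := hsep x y hxy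
    exact ⟨O, O', TopologicalSpace.isOpen_generateFrom_of_mem hO,
      TopologicalSpace.isOpen_generateFrom_of_mem hO', hx, hy, hd⟩
  have hle : t ≤ t' := le_generateFrom hSo
  have hcont : @Continuous X X t t' id := continuous_id_iff_le.2 hle
  have hemb : @Topology.IsClosedEmbedding X X t t' id :=
    @Continuous.isClosedEmbedding X X t t' _ hT2 id hcont Function.injective_id
  have hind : @Topology.IsInducing X X t t' id :=
    @Topology.IsClosedEmbedding.isInducing X X id t t' hemb
  have heq : t = t' := (@Topology.IsInducing.eq_induced X X t t' id hind).trans induced_id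
  exact @SecondCountableTopology.mk X t ⟨S, hS, heq⟩

open Set in
/-- A compact Hausdorff space with a countable family of sets that finitely refines every open
cover is second countable. -/
theorem secondCountableTopology_of_countable_finite_refinement {X : Type*} [TopologicalSpace X]
    [T2Space X] [CompactSpace X] {C : Set (Set X)} (hC : C.Countable)
    (h : ∀ 𝒰 : Set (Set X), (∀ U ∈ 𝒰, IsOpen U) → ⋃₀ 𝒰 = univ →
      ∃ F : Set (Set X), F.Finite ∧ F ⊆ C ∧ ⋃₀ F = univ ∧ ∀ P ∈ F, ∃ U ∈ 𝒰, P ⊆ U) :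
    SecondCountableTopology X := by
  let O : Set (Set X) → Set X := fun F => (⋃ P ∈ F, closure P)ᶜ
  refine secondCountableTopology_of_countable_separating
    (S := O '' {F | F.Finite ∧ F ⊆ C}) ((countable_ofPred_finite_subset hC).image O) ?_ ?_
  · rintro _ ⟨F, ⟨hF, -⟩, rfl⟩
    exact (hF.isClosed_biUnion fun P _ => isClosed_closure).isOpen_compl
  intro x y hxy
  obtain ⟨U, hxU, hU, V, hyV, hV, hUV⟩ := exists_open_nhds_disjoint_closure hxy
  obtain ⟨F, hF, hFC, hFc, hFU⟩ := h {(closure U)ᶜ, (closure V)ᶜ}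
    (by
      rintro _ (rfl | rfl) <;> exact isClosed_closure.isOpen_compl)
    (by rw [sUnion_pair, ← compl_inter, hUV.inter_eq, compl_empty])
  have hnot : ∀ {W P : Set X} {z : X}, IsOpen W → z ∈ W → P ⊆ (closure W)ᶜ → z ∉ closure P := by
    intro W P z hW hz hP hzP
    obtain ⟨w, hw, hwP⟩ := mem_closure_iff.1 hzP W hW hz
    exact hP hwP (subset_closure hw)
  have hmem : ∀ z : X, z ∈ O {P ∈ F | z ∉ closure P} := fun z hz => by
    simp only [mem_iUnion] at hz
    obtain ⟨P, hP, hzP⟩ := hz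
    exact hP.2 hzP
  refine ⟨_, ⟨{P ∈ F | x ∉ closure P}, ⟨hF.subset (sep_subset _ _),
    (sep_subset _ _).trans hFC⟩, rfl⟩, _, ⟨{P ∈ F | y ∉ closure P}, ⟨hF.subset (sep_subset _ _),
    (sep_subset _ _).trans hFC⟩, rfl⟩, hmem x, hmem y, disjoint_left.2 fun z hzx hzy => ?_⟩
  obtain ⟨P, hP, hzP⟩ := mem_sUnion.1 (hFc ▸ mem_univ z : z ∈ ⋃₀ F)
  obtain ⟨_, rfl | rfl, hPW⟩ := hFU P hP
  · exact hzx (mem_biUnion (show P ∈ {P ∈ F | x ∉ closure P} from ⟨hP, hnot hU hxU hPW⟩)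
      (subset_closure hzP))
  · exact hzy (mem_biUnion (show P ∈ {P ∈ F | y ∉ closure P} from ⟨hP, hnot hV hyV hPW⟩)
      (subset_closure hzP))

/-- A Hausdorff countably compact space with a point-countable Pytkeev network is
a metrizable compact space. -/
theorem countablyCompact_pointCountable_pytkeev_metrizable_compact
    {X : Type*} [TopologicalSpace X] [T2Space X]
    (hcc : IsCountablyCompactSpace X)
    (N : Set (Set X)) (hN : IsPytkeevNetwork N) (hpc : IsPointCountable N) :
    CompactSpace X ∧ TopologicalSpace.MetrizableSpace X := by
  obtain ⟨C, hC, href⟩ := hN.exists_countable_finite_refinement hcc hpc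
  have hcompact : CompactSpace X := compactSpace_of_finite_refinement fun 𝒰 hUo hUc => by
    obtain ⟨F, hF, -, hFc, hFU⟩ := href 𝒰 hUo hUc
    exact ⟨F, hF, hFc, hFU⟩
  have hsc : SecondCountableTopology X :=
    secondCountableTopology_of_countable_finite_refinement hC href
  exact ⟨hcompact, inferInstance⟩
end

section
/- Let X be a topological space with a point-countable Pytkeev network 𝒩. Then for every countably compact subset K of X (countably compact in the subspace topology) and every open set U of X with K ⊆ U, there exists a finite subfamily ℱ ⊆ 𝒩 such that K ⊆ ⋃ℱ ⊆ U. -/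
/-- `K` is a countably compact subset of `X`: every infinite subset of `K` has an
accumulation point lying in `K`. -/
def IsCountablyCompactSubset {X : Type*} [TopologicalSpace X] (K : Set X) : Prop :=
  ∀ A ⊆ K, A.Infinite → ∃ x ∈ K, IsAccumulationPt x A

/-- If `X` has a point-countable Pytkeev network `N`, then every countably compact subset
`K` contained in an open set `U` is covered by a finite subfamily of `N` lying inside `U`. -/
theorem countablyCompact_subset_finite_cover_of_pointCountable_pytkeev
    {X : Type*} [TopologicalSpace X]
    (N : Set (Set X)) (hN : IsPytkeevNetwork N) (hpc : IsPointCountable N)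
    (K : Set X) (hK : IsCountablyCompactSubset K)
    (U : Set X) (hU : IsOpen U) (hKU : K ⊆ U) :
    ∃ F ⊆ N, F.Finite ∧ K ⊆ ⋃₀ F ∧ ⋃₀ F ⊆ U := by
  by_contra hcon
  have hex : ∀ x, ∃ f : ℕ → Set X, x ∈ K → Set.range f = {P ∈ N | x ∈ P ∧ P ⊆ U} := by
    intro x
    by_cases hx : x ∈ K
    · have hc : {P ∈ N | x ∈ P ∧ P ⊆ U}.Countable :=
        (hpc x).mono (by rintro P ⟨hPN, hxP, -⟩; exact ⟨hPN, hxP⟩)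
      obtain ⟨P, hPN, hxP, hPU⟩ := (hN x).1 U hU (hKU hx)
      obtain ⟨f, hf⟩ := hc.exists_eq_range ⟨P, hPN, hxP, hPU⟩
      exact ⟨f, fun _ => hf.symm⟩
    · exact ⟨fun _ => ∅, fun h => absurd h hx⟩
  choose f hf using hex
  have hmem : ∀ x ∈ K, ∀ k, f x k ∈ N ∧ x ∈ f x k ∧ f x k ⊆ U := by
    intro x hx k
    have h : f x k ∈ Set.range (f x) := ⟨k, rfl⟩
    rwa [hf x hx] at h
  -- The second coordinate bounds how much of each enumeration has been avoided so far.
  obtain ⟨g, hgK, hg⟩ := exists_seq_of_forall_finset_exists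
    (fun p : X × ℕ => p.1 ∈ K) (fun p q => p.2 < q.2 ∧ ∀ k < q.2, q.1 ∉ f p.1 k) (by
      intro s hs
      let n := s.sup Prod.snd + 1
      let F : Set (Set X) := ⋃ p ∈ s, f p.1 '' Set.Iio n
      have hFfin : F.Finite :=
        s.finite_toSet.biUnion fun p _ => (Set.finite_Iio n).image _
      have hF : ∀ P ∈ F, P ∈ N ∧ P ⊆ U := by
        intro P hP
        simp only [F, Set.mem_iUnion] at hP
        obtain ⟨p, hp, k, -, rfl⟩ := hP
        exact ⟨(hmem _ (hs p hp) k).1, (hmem _ (hs p hp) k).2.2⟩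
      have hnot : ¬ K ⊆ ⋃₀ F := fun h =>
        hcon ⟨F, fun P hP => (hF P hP).1, hFfin, h, Set.sUnion_subset fun P hP => (hF P hP).2⟩
      obtain ⟨x, hxK, hx⟩ := Set.not_subset.1 hnot
      refine ⟨(x, n), hxK, fun p hp => ⟨Nat.lt_succ_of_le (Finset.le_sup hp), ?_⟩⟩
      intro k hk hxk
      exact hx ⟨f p.1 k, Set.mem_iUnion₂.2 ⟨p, hp, k, hk, rfl⟩, hxk⟩)
  have hmono : StrictMono fun n => (g n).2 := fun m n h => (hg m n h).1
  have hne : ∀ m n, m < n → (g m).1 ≠ (g n).1 := by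
    intro m n h e
    obtain ⟨h₁, h₂⟩ := hg m n h
    exact h₂ 0 (Nat.zero_lt_of_lt h₁) (e ▸ (hmem _ (hgK m) 0).2.1)
  have hinj : Function.Injective fun n => (g n).1 := by
    intro m n e
    by_contra hmn
    rcases lt_or_gt_of_ne hmn with h | h
    · exact hne m n h e
    · exact hne n m h e.symm
  obtain ⟨x, hxK, hx⟩ := hK (Set.range fun n => (g n).1)
    (Set.range_subset_iff.2 hgK) (Set.infinite_range_of_injective hinj)
  obtain ⟨P, hPN, hPU, hPinf⟩ := (hN x).2 U hU (hKU hxK) _ hx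
  obtain ⟨_, hiP, i, rfl⟩ := hPinf.nonempty
  have hP : P ∈ Set.range (f (g i).1) := by
    rw [hf _ (hgK i)]
    exact ⟨hPN, hiP, hPU⟩
  obtain ⟨k, rfl⟩ := hP
  refine hPinf (((Set.finite_Iic (max i k)).image fun n => (g n).1).subset ?_)
  rintro _ ⟨hnP, n, rfl⟩
  refine ⟨n, ?_, rfl⟩
  by_contra hn
  obtain ⟨hin, hkn⟩ := max_lt_iff.1 (not_le.1 (Set.mem_Iic.not.1 hn))
  exact (hg i n hin).2 k (hkn.trans_le (hmono.le_apply)) hnP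
end

section
/- Suppose that for each n ∈ ℕ, Xₙ is a topological space with a 𝔊-base. Then the countable product Π_{n∈ℕ} Xₙ (with the product topology) has a 𝔊-base. -/
/-- A topological space has a `𝔊`-base if there is a base `{U α : α ∈ ℕ^ℕ}` of open sets
for the topology with `U β ⊆ U α` whenever `α ≤ β` (coordinatewise order on `ℕ^ℕ`). -/
def HasGBase (X : Type*) [TopologicalSpace X] : Prop :=
  ∃ U : (ℕ → ℕ) → Set X,
    (∀ α, IsOpen (U α)) ∧
    (∀ α β : ℕ → ℕ, α ≤ β → U β ⊆ U α) ∧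
    (∀ V : Set X, IsOpen V → ∀ x ∈ V, ∃ α, x ∈ U α ∧ U α ⊆ V)

/-- A countable product of topological spaces with a `𝔊`-base has a `𝔊`-base. -/
theorem hasGBase_pi {X : ℕ → Type*} [∀ n, TopologicalSpace (X n)]
    (h : ∀ n, HasGBase (X n)) : HasGBase (∀ n, X n) := by
  choose U hopen hanti hbase using h
  -- `α 0` bounds the restricted coordinates; the rest of `α` codes one index per coordinate.
  refine ⟨fun α => (Set.Iio (α 0)).pi fun n => U n fun k => α (Nat.pair n k + 1),
    fun α => isOpen_set_pi (Set.finite_Iio _) fun n _ => hopen n _, ?_, ?_⟩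
  · intro α β hαβ x hx n hn
    exact hanti n _ _ (fun k => hαβ _) (hx n (lt_of_lt_of_le hn (hαβ 0)))
  · intro V hV x hx
    obtain ⟨I, u, hu, hIV⟩ := isOpen_pi_iff.1 hV x hx
    have hindex : ∀ n, ∃ a, x n ∈ U n a ∧ (n ∈ I → U n a ⊆ u n) := by
      intro n
      by_cases hn : n ∈ I
      · obtain ⟨a, hxa, hau⟩ := hbase n (u n) (hu n hn).1 (x n) (hu n hn).2
        exact ⟨a, hxa, fun _ => hau⟩
      · obtain ⟨a, hxa, -⟩ := hbase n Set.univ isOpen_univ (x n) trivial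
        exact ⟨a, hxa, fun hnI => absurd hnI hn⟩
    choose a hxa hau using hindex
    refine ⟨fun i => Nat.casesOn i (I.sup id + 1) fun j => a j.unpair.1 j.unpair.2, ?_, ?_⟩
    · intro n _
      simpa using hxa n
    · intro y hy
      refine hIV fun n hn => hau n hn ?_
      have hlt : n < I.sup id + 1 := Nat.lt_succ_of_le (Finset.le_sup (f := id) hn)
      simpa using hy n hlt
end

section
/- Suppose that for each n ∈ ℕ, Xₙ is a topological space that has a local 𝔊-base at each of its points. Then the countable product Π_{n∈ℕ} Xₙ (with the product topology) has a local 𝔊-base at each of its points. -/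
/-- A topological space has a local `𝔊`-base at a point `x` if there is a family
`{U α : α ∈ ℕ^ℕ}` of neighborhoods of `x`, decreasing with respect to the coordinatewise
order on `ℕ^ℕ`, such that every neighborhood of `x` contains some `U α`. -/
def HasLocalGBaseAt (X : Type*) [TopologicalSpace X] (x : X) : Prop :=
  ∃ U : (ℕ → ℕ) → Set X,
    (∀ α, U α ∈ nhds x) ∧
    (∀ α β : ℕ → ℕ, α ≤ β → U β ⊆ U α) ∧
    (∀ V ∈ nhds x, ∃ α, U α ⊆ V)

/-- A countable product of spaces each having a local `𝔊`-base at each point has a local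
`𝔊`-base at each of its points. -/
theorem hasLocalGBaseAt_pi {X : ℕ → Type*} [∀ n, TopologicalSpace (X n)]
    (h : ∀ n, ∀ x : X n, HasLocalGBaseAt (X n) x) :
    ∀ x : ∀ n, X n, HasLocalGBaseAt (∀ n, X n) x := by
  intro x
  choose U hU hmono hbase using fun n => h n (x n)
  -- `α 0` bounds the restricted coordinates; the rest of `α` codes one sequence per coordinate.
  refine ⟨fun α => (Set.Iio (α 0)).pi fun n => U n fun k => α (Nat.pair n k + 1), ?_, ?_, ?_⟩
  · exact fun α => set_pi_mem_nhds (Set.finite_Iio _) fun n _ => hU n _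
  · exact fun α β hαβ y hy n hn =>
      hmono n _ _ (fun k => hαβ _) (hy n (lt_of_lt_of_le hn (hαβ 0)))
  · intro V hV
    rw [nhds_pi, Filter.mem_pi] at hV
    obtain ⟨I, hI, t, ht, hIV⟩ := hV
    obtain ⟨N, hN⟩ := hI.bddAbove
    choose a ha using fun n => hbase n (t n) (ht n)
    refine ⟨fun
      | 0 => N + 1
      | m + 1 => a m.unpair.1 m.unpair.2, fun y hy => hIV fun n hn => ha n ?_⟩
    simpa using hy n (Nat.lt_succ_of_le (hN hn))
end

section
/- If a topological space X has a local 𝔊-base at a point x ∈ X, then X has a countable cs*-network at x (i.e., X is of countable cs*-character at x). -/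
/-- `P` is a `cs*`-network at `x`: for every sequence converging to `x` and every open `U`
containing `x`, some member of `P` contains `x` together with a subsequence, and lies in `U`. -/
def IsCsStarNetworkAt {X : Type*} [TopologicalSpace X] (P : Set (Set X)) (x : X) : Prop :=
  ∀ u : ℕ → X, Filter.Tendsto u Filter.atTop (nhds x) →
    ∀ U : Set X, IsOpen U → x ∈ U →
      ∃ p ∈ P, ∃ φ : ℕ → ℕ, StrictMono φ ∧
        insert x (Set.range (u ∘ φ)) ⊆ p ∧ p ⊆ U

/-- The intersection of all `U β` such that `β` extends the finite sequence `s`. -/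
def cylinderInter {X : Type*} (U : (ℕ → ℕ) → Set X) (s : Σ k : ℕ, Fin k → ℕ) : Set X :=
  {y | ∀ β : ℕ → ℕ, (∀ i : Fin s.1, β i = s.2 i) → y ∈ U β}

/-- Sequences `β k` that agree with `α` below `k` have a common coordinatewise upper bound. -/
theorem exists_forall_le_of_eq_below {α : ℕ → ℕ} {β : ℕ → ℕ → ℕ}
    (hβ : ∀ k, ∀ i < k, β k i = α i) : ∃ γ : ℕ → ℕ, ∀ k, β k ≤ γ := by
  refine ⟨fun i => α i + ∑ k ∈ Finset.range (i + 1), β k i, fun k i => ?_⟩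
  rcases lt_or_ge i k with hik | hki
  · exact (hβ k i hik).le.trans (Nat.le_add_right _ _)
  · exact (Finset.single_le_sum (f := fun k => β k i) (fun _ _ => Nat.zero_le _)
      (Finset.mem_range.2 (Nat.lt_succ_of_le hki))).trans (Nat.le_add_left _ _)

/-- A sequence converging to `x` frequently visits the intersection of all `U β` for which `β`
extends some fixed initial segment of `α`. -/
theorem exists_frequently_mem_cylinderInter {X : Type*} [TopologicalSpace X] {x : X}
    {U : (ℕ → ℕ) → Set X} (hU : ∀ α, U α ∈ nhds x)
    (hanti : ∀ α β : ℕ → ℕ, α ≤ β → U β ⊆ U α) {u : ℕ → X}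
    (hu : Filter.Tendsto u Filter.atTop (nhds x)) (α : ℕ → ℕ) :
    ∃ k : ℕ, ∃ᶠ n in Filter.atTop, u n ∈ cylinderInter U ⟨k, fun i => α i⟩ := by
  by_contra! hfin
  have hout : ∀ k, ∃ n ≥ k, ∃ β : ℕ → ℕ, (∀ i < k, β i = α i) ∧ u n ∉ U β := by
    intro k
    obtain ⟨n, hn, hkn⟩ :=
      ((hfin k).and (Filter.eventually_ge_atTop k)).exists
    simp only [cylinderInter, Set.mem_ofPred_eq, not_forall] at hn
    obtain ⟨β, hβ, hnβ⟩ := hn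
    exact ⟨n, hkn, β, fun i hi => hβ ⟨i, hi⟩, hnβ⟩
  choose n hn β hβ hnβ using hout
  obtain ⟨γ, hγ⟩ := exists_forall_le_of_eq_below hβ
  obtain ⟨N, hN⟩ := Filter.eventually_atTop.1 (hu (hU γ))
  exact hnβ N (hanti _ _ (hγ N) (hN _ (hn N)))

/-- If `X` has a local `𝔊`-base at `x`, then `X` has a countable `cs*`-network at `x`. -/
theorem countable_csStar_network_of_hasLocalGBaseAt {X : Type*} [TopologicalSpace X] (x : X)
    (h : HasLocalGBaseAt X x) :
    ∃ P : Set (Set X), P.Countable ∧ IsCsStarNetworkAt P x := by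
  obtain ⟨U, hU, hanti, hbase⟩ := h
  refine ⟨Set.range (cylinderInter U), Set.countable_range _, fun u hu V hV hxV => ?_⟩
  obtain ⟨α, hα⟩ := hbase V (hV.mem_nhds hxV)
  obtain ⟨k, hk⟩ := exists_frequently_mem_cylinderInter hU hanti hu α
  obtain ⟨φ, hφ, hmem⟩ := Filter.extraction_of_frequently_atTop hk
  refine ⟨_, ⟨_, rfl⟩, φ, hφ, Set.insert_subset ?_ (Set.range_subset_iff.2 hmem), ?_⟩
  · exact fun β _ => mem_of_mem_nhds (hU β)
  · exact fun y hy => hα (hy α fun _ => rfl)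
end
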